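/- Let f₁(x), …, f_U(x) ∈ R_m and let C = C_{t₁} ⊕ ⋯ ⊕ C_{t_U} be a one-generator quasi-cyclic code of length lm and index l over F_q, where 0 ≤ t₁ < ⋯ < t_U ≤ s, each C_{t_j} is a linear code over R_m ε_{t_j} of dimension 1 and length l with generator matrix [a_{j,0}(x), …, a_{j,l−1}(x)] over R_m ε_{t_j} in which each a_{j,v} ∈ {0, f_j(x)}, and C_{t_j} is, as an F_q-code, an [lm, k_{t_j}] quasi-cyclic code; the primitive idempotent ε_{t_j} corresponds to the q-cyclotomic coset {i_{t_j}, i_{t_j}q, …, i_{t_j}q^{k_{t_j}−1}} modulo m. Then the number of orbits of ⟨μ_q, ρ^l, M⟩ on C* = C \ {0} is equal to Σ_{∅ ≠ {j₁ < ⋯ < j_u} ⊆ {1,…,U}} N_{j₁,…,j_u}, where, writing I = q−1 and, for each index r of summation, I_{t_{j_v}} = (q^{k_{t_{j_v}}} − 1)/(q^{gcd(k_{t_{j_v}}, r)} − 1), one has N_{j₁,…,j_u} = (1/(m'·m·(q−1)))·Σ_{r=0}^{m'−1} gcd(m, i_{t_{j₁}}·I·I_{t_{j₁}}/gcd(I,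 I_{t_{j₁}}), …, i_{t_{j_u}}·I·I_{t_{j_u}}/gcd(I, I_{t_{j_u}}), together with (i_{t_{j_{v'}}} − i_{t_{j_v}})·I_{t_{j_v}}·I_{t_{j_{v'}}}/gcd(I_{t_{j_v}}, I_{t_{j_{v'}}}) for all pairs 1 ≤ v < v' ≤ u)·gcd(I, I_{t_{j₁}}, …, I_{t_{j_u}})·∏_{v=1}^{u}(q^{gcd(k_{t_{j_v}}, r)} − 1). In particular, the number of distinct nonzero Hamming weights s(C) is less than or equal to the number of orbits of ⟨μ_q, ρ^l, M⟩ on C*. -/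

import Mathlib

/-- The shift `ρ^l` on `F^{lm}`, with a codeword indexed as `c (i, j) = c_{ij}`
(`i ∈ ZMod m` the block index, `j ∈ Fin l` the position inside a block):
`(ρ^l c) (i, j) = c (i - 1, j)`. -/
noncomputable def shiftQC (F : Type*) [Field F] (m l : ℕ) :
    ((ZMod m × Fin l) → F) ≃ₗ[F] ((ZMod m × Fin l) → F) :=
  LinearEquiv.funCongrLeft F F ((Equiv.subRight (1 : ZMod m)).prodCongr (Equiv.refl (Fin l)))

/-- The multiplier `μ_q` on `F^{lm}` determined by the unit `u = q` of `ZMod m`: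
under the identification with `R_m^l` it sends `Σ c_i x^i ↦ Σ c_i x^{q i}` in every
component, i.e. `(μ_q c) (i, j) = c (q⁻¹ i, j)`. -/
noncomputable def multiplierQC (F : Type*) [Field F] (m l : ℕ) (u : (ZMod m)ˣ) :
    ((ZMod m × Fin l) → F) ≃ₗ[F] ((ZMod m × Fin l) → F) :=
  LinearEquiv.funCongrLeft F F ((MulAction.toPerm u⁻¹).prodCongr (Equiv.refl (Fin l)))

/-- The `q`-cyclotomic coset of `i_t` modulo `m`, viewed inside `ZMod m`. -/
def cycCoset (q m it : ℕ) : Set (ZMod m) :=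
  {j | ∃ r : ℕ, j = (it : ZMod m) * (q : ZMod m) ^ r}

/-- Evaluation of the polynomial `Σ_i c_i x^i ∈ R_m = F[x]/(x^m - 1)` at `ζ^j`, computed in
an extension field `E` of `F` containing the primitive `m`-th root of unity `ζ`. -/
noncomputable def evalDFT {F E : Type*} [Field F] [Field E] [Algebra F E] {m : ℕ} [NeZero m]
    (ζ : E) (c : ZMod m → F) (j : ZMod m) : E :=
  ∑ i : ZMod m, algebraMap F E (c i) * ζ ^ (i * j).val

/-- `Σ_i c_i x^i` lies in the minimal ideal `R_m ε_t` of `R_m` associated with the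
`q`-cyclotomic coset of `i_t`, i.e. it vanishes at `ζ^j` for every `j` outside the coset. -/
def inMinIdeal {F E : Type*} [Field F] [Field E] [Algebra F E] (q : ℕ) {m : ℕ} [NeZero m]
    (ζ : E) (it : ℕ) (c : ZMod m → F) : Prop :=
  ∀ j : ZMod m, j ∉ cycCoset q m it → evalDFT ζ c j = 0

/-- Multiplication (cyclic convolution) in `R_m = F[x]/(x^m - 1)`, on coefficient vectors. -/
noncomputable def cconv {F : Type*} [Field F] {m : ℕ} [NeZero m] (g h : ZMod m → F) :
    ZMod m → F := fun i => ∑ i' : ZMod m, g i' * h (i - i')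

/-- `I_{t_j} = (q^{k_{t_j}} - 1)/(q^{gcd(k_{t_j}, r)} - 1)`. -/
def Ifac (q kj r : ℕ) : ℕ := (q ^ kj - 1) / (q ^ Nat.gcd kj r - 1)

/-- The inner gcd
`gcd(m, i_{t_{j₁}} I I_{t_{j₁}}/gcd(I, I_{t_{j₁}}), …,
 (i_{t_{j_{v'}}} - i_{t_{j_v}}) I_{t_{j_v}} I_{t_{j_{v'}}}/gcd(I_{t_{j_v}}, I_{t_{j_{v'}}}), …)`
appearing in `N_{j₁,…,j_u}`, where `I = q - 1` and the differences are taken up to sign. -/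
def bigGcd (q m : ℕ) {U : ℕ} (it k : Fin U → ℕ) (S : Finset (Fin U)) (r : ℕ) : ℕ :=
  Nat.gcd m (Nat.gcd
    (S.gcd fun j => it j * ((q - 1) * Ifac q (k j) r / Nat.gcd (q - 1) (Ifac q (k j) r)))
    (((S ×ˢ S).filter fun p => p.1 < p.2).gcd fun p =>
      ((it p.2 : ℤ) - (it p.1 : ℤ)).natAbs *
        (Ifac q (k p.1) r * Ifac q (k p.2) r / Nat.gcd (Ifac q (k p.1) r) (Ifac q (k p.2) r))))

/-- In a finite cyclic group of order `n`, the equation `x ^ d = y` has `gcd n d` solutions if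
`y ^ (n / gcd n d) = 1`, and none otherwise. -/
theorem IsCyclic.ncard_pow_eq {G : Type*} [CommGroup G] [IsCyclic G] [Finite G] (d : ℕ) (y : G)
    [Decidable (y ^ (Nat.card G / (Nat.card G).gcd d) = 1)] :
    {x : G | x ^ d = y}.ncard =
      if y ^ (Nat.card G / (Nat.card G).gcd d) = 1 then (Nat.card G).gcd d else 0 := by
  set n := Nat.card G with hn
  have hn0 : 0 < n := Nat.card_pos
  have hg : 0 < n.gcd d := Nat.gcd_pos_of_pos_left _ hn0
  have hrange : (powMonoidHom d : G →* G).range = (powMonoidHom (n / n.gcd d) : G →* G).ker := by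
    apply Subgroup.eq_of_le_of_card_ge
    · rintro _ ⟨x, rfl⟩
      obtain ⟨e, he⟩ := Nat.gcd_dvd_right n d
      simp only [MonoidHom.mem_ker, powMonoidHom_apply]
      rw [← pow_mul]
      have : d * (n / n.gcd d) = n * e := by
        obtain ⟨c, hc⟩ := Nat.gcd_dvd_left n d
        rw [Nat.div_eq_of_eq_mul_right hg hc]
        calc d * c = n.gcd d * e * c := by rw [← he]
          _ = n.gcd d * c * e := by ring
          _ = n * e := by rw [← hc]
      rw [this, pow_mul, hn, pow_card_eq_one', one_pow]
    · rw [IsCyclic.card_powMonoidHom_ker, IsCyclic.card_powMonoidHom_range, ← hn,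
        Nat.gcd_eq_right (Nat.div_dvd_of_dvd (Nat.gcd_dvd_left n d))]
  have hiff : y ^ (n / n.gcd d) = 1 ↔ ∃ x : G, x ^ d = y := by
    have := SetLike.ext_iff.1 hrange y
    simpa [MonoidHom.mem_ker] using this.symm
  split_ifs with h
  · obtain ⟨x₀, hx₀⟩ := hiff.1 h
    have himg : {x : G | x ^ d = y} =
        (x₀ * ·) '' ((powMonoidHom d : G →* G).ker : Set G) := by
      ext x
      simp only [Set.mem_ofPred_eq, Set.mem_image, SetLike.mem_coe, MonoidHom.mem_ker,
        powMonoidHom_apply]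
      constructor
      · intro hx
        exact ⟨x₀⁻¹ * x, by rw [mul_pow, hx, inv_pow, hx₀, inv_mul_cancel], by simp⟩
      · rintro ⟨z, hz, rfl⟩
        rw [mul_pow, hz, hx₀, mul_one]
    rw [himg, Set.ncard_image_of_injective _ (mul_right_injective x₀)]
    exact IsCyclic.card_powMonoidHom_ker (G := G) d
  · rw [Set.ncard_eq_zero]
    ext x
    simpa using fun hx => h (hiff.2 ⟨x, hx⟩)

/-- The equations `a ^ i = z` and `a ^ j = w` satisfy the same multiplicative relations as their
exponents. -/
def PowCompat {Γ : Type*} [CommGroup Γ] (i : ℕ) (z : Γ) (j : ℕ) (w : Γ) : Prop :=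
  ∀ s t : ℤ, s * i = t * j → z ^ s = w ^ t

theorem PowCompat.symm {Γ : Type*} [CommGroup Γ] {i j : ℕ} {z w : Γ} (h : PowCompat i z j w) :
    PowCompat j w i z := fun s t hst => (h t s hst.symm).symm

/-- Two compatible equations `a ^ i = z`, `a ^ j = w` amount to one equation with exponent
`gcd i j`. -/
theorem PowCompat.merge {Γ : Type*} [CommGroup Γ] {i j : ℕ} {z w : Γ} (h : PowCompat i z j w)
    (hi : 0 < i) :
    ∃ v : Γ, (∀ a : Γ, a ^ (i.gcd j) = v ↔ a ^ i = z ∧ a ^ j = w) ∧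
      ∀ (n : ℕ) (y : Γ), PowCompat i z n y → PowCompat j w n y → PowCompat (i.gcd j) v n y := by
  have hg : (0 : ℤ) < (i.gcd j : ℕ) := by exact_mod_cast Nat.gcd_pos_of_pos_left _ hi
  have hb := Nat.gcd_eq_gcd_ab i j
  set g := i.gcd j with hgdef
  set α := i.gcdA j
  set β := i.gcdB j
  obtain ⟨i', hi'⟩ : g ∣ i := Nat.gcd_dvd_left i j
  obtain ⟨j', hj'⟩ : g ∣ j := Nat.gcd_dvd_right i j
  have hiz : (i : ℤ) = g * i' := by exact_mod_cast hi'
  have hjz : (j : ℤ) = g * j' := by exact_mod_cast hj'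
  have hone : (i' : ℤ) * α + j' * β = 1 := by
    have : (g : ℤ) * (i' * α + j' * β) = g * 1 := by
      rw [mul_one, mul_add, ← mul_assoc, ← mul_assoc, ← hiz, ← hjz]; exact hb.symm
    exact mul_left_cancel₀ hg.ne' this
  have hzw : z ^ (j' : ℤ) = w ^ (i' : ℤ) := h _ _ (by rw [hiz, hjz]; ring)
  refine ⟨z ^ α * w ^ β, fun a => ⟨fun ha => ⟨?_, ?_⟩, ?_⟩, fun n y hz hw s t hst => ?_⟩
  · calc a ^ i = (a ^ g) ^ (i' : ℤ) := by rw [hi', pow_mul, zpow_natCast]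
      _ = z ^ (i' * α) * (w ^ (i' : ℤ)) ^ β := by
        rw [ha, mul_zpow, ← zpow_mul, ← zpow_mul, ← zpow_mul, mul_comm α, mul_comm β]
      _ = z := by rw [← hzw, ← zpow_mul, ← zpow_add, hone, zpow_one]
  · calc a ^ j = (a ^ g) ^ (j' : ℤ) := by rw [hj', pow_mul, zpow_natCast]
      _ = (z ^ (j' : ℤ)) ^ α * w ^ (j' * β) := by
        rw [ha, mul_zpow, ← zpow_mul, ← zpow_mul, ← zpow_mul, mul_comm α, mul_comm β]
      _ = w := by rw [hzw, ← zpow_mul, ← zpow_add, hone, zpow_one]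
  · rintro ⟨rfl, rfl⟩
    rw [← zpow_natCast a i, ← zpow_natCast a j, ← zpow_mul, ← zpow_mul, ← zpow_add, ← hb,
      zpow_natCast]
  · have h1 : z ^ s = y ^ (t * i') := hz _ _ (by rw [hiz]; linear_combination (i' : ℤ) * hst)
    have h2 : w ^ s = y ^ (t * j') := hw _ _ (by rw [hjz]; linear_combination (j' : ℤ) * hst)
    calc (z ^ α * w ^ β) ^ s = (z ^ s) ^ α * (w ^ s) ^ β := by
          rw [mul_zpow, ← zpow_mul, ← zpow_mul, ← zpow_mul, ← zpow_mul, mul_comm α, mul_comm β]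
      _ = y ^ (t * (i' * α + j' * β)) := by
          rw [h1, h2, ← zpow_mul, ← zpow_mul, ← zpow_add]; congr 1; ring
      _ = y ^ t := by rw [hone, mul_one]

/-- A pairwise compatible system of equations `a ^ n = 1`, `a ^ I j = z j` amounts to a single
equation `a ^ g = v` where `g` is the gcd of the exponents. -/
theorem PowCompat.merge_finset {Γ ι : Type*} [CommGroup Γ] {n : ℕ} (hn : 0 < n) (I : ι → ℕ)
    (z : ι → Γ) (S : Finset ι) (h₀ : ∀ j ∈ S, PowCompat n 1 (I j) (z j))
    (h : ∀ i ∈ S, ∀ j ∈ S, PowCompat (I i) (z i) (I j) (z j)) :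
    ∃ v : Γ, (∀ a : Γ, a ^ (n.gcd (S.gcd I)) = v ↔ a ^ n = 1 ∧ ∀ j ∈ S, a ^ I j = z j) ∧
      ∀ (e : ℕ) (y : Γ), PowCompat n 1 e y → (∀ j ∈ S, PowCompat (I j) (z j) e y) →
        PowCompat (n.gcd (S.gcd I)) v e y := by
  classical
  induction S using Finset.induction_on with
  | empty => exact ⟨1, by simp, fun e y h1 _ => by simpa using h1⟩
  | insert j S hj ih =>
    obtain ⟨v, hv, hc⟩ := ih (fun i hi => h₀ i (Finset.mem_insert_of_mem hi))
      fun i hi i' hi' => h i (Finset.mem_insert_of_mem hi) i' (Finset.mem_insert_of_mem hi')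
    obtain ⟨v', hv', hc'⟩ := (hc (I j) (z j) (h₀ j (Finset.mem_insert_self _ _))
      fun i hi => h i (Finset.mem_insert_of_mem hi) j (Finset.mem_insert_self _ _)).merge
        (Nat.gcd_pos_of_pos_left _ hn)
    have hgcd : n.gcd ((insert j S).gcd I) = (n.gcd (S.gcd I)).gcd (I j) := by
      rw [Finset.gcd_insert, Nat.gcd_assoc]
      congr 1
      exact Nat.gcd_comm _ _
    refine ⟨v', fun a => ?_, fun e y h1 h2 => ?_⟩
    · rw [hgcd, hv', hv, Finset.forall_mem_insert]
      tauto
    · rw [hgcd]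
      exact hc' e y (hc e y h1 fun i hi => h2 i (Finset.mem_insert_of_mem hi))
        (h2 j (Finset.mem_insert_self _ _))

theorem powCompat_zpow_iff {Γ : Type*} [CommGroup Γ] (Z : Γ) (i j : ℕ) (x y : ℤ) :
    PowCompat i (Z ^ (x * i)) j (Z ^ (y * j)) ↔ (orderOf Z : ℤ) ∣ (x - y) * (Nat.lcm i j : ℕ) := by
  have key : ∀ L : ℤ, Z ^ (x * L) = Z ^ (y * L) ↔ (orderOf Z : ℤ) ∣ (x - y) * L := by
    intro L
    rw [zpow_eq_zpow_iff_modEq, Int.modEq_comm, Int.modEq_iff_dvd, sub_mul]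
  constructor
  · intro h
    obtain ⟨s, hs⟩ := Nat.dvd_lcm_left i j
    obtain ⟨t, ht⟩ := Nat.dvd_lcm_right i j
    have hs' : ((Nat.lcm i j : ℕ) : ℤ) = i * s := by exact_mod_cast hs
    have ht' : ((Nat.lcm i j : ℕ) : ℤ) = j * t := by exact_mod_cast ht
    rw [← key]
    have := h s t (by rw [mul_comm, ← hs', ht', mul_comm])
    rw [← zpow_mul, ← zpow_mul, mul_assoc, mul_assoc, ← hs', ← ht'] at this
    exact this
  · intro h s t hst
    rw [← zpow_mul, ← zpow_mul, mul_assoc, mul_assoc, mul_comm (i : ℤ), mul_comm (j : ℤ), ← hst,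
      key]
    have hL : ((Nat.lcm i j : ℕ) : ℤ) ∣ s * i := by
      have := lcm_dvd (Dvd.intro_left s rfl : (i : ℤ) ∣ s * i)
        (hst ▸ Dvd.intro_left t rfl : (j : ℤ) ∣ s * i)
      simpa [← Int.coe_lcm, Int.lcm] using this
    exact h.trans (mul_dvd_mul_left _ hL)

theorem ZMod.ncard_dvd_val_mul (m : ℕ) [NeZero m] (D : ℕ) :
    {t : ZMod m | m ∣ t.val * D}.ncard = m.gcd D := by
  classical
  have h := IsCyclic.ncard_pow_eq (G := Multiplicative (ZMod m)) D 1
  rw [if_pos (one_pow _)] at h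
  have hc : Nat.card (Multiplicative (ZMod m)) = m := by simp
  rw [hc] at h
  rw [← h, ← Set.ncard_image_of_injective _ Multiplicative.ofAdd.injective]
  congr 1
  ext x
  simp only [Set.mem_image, Set.mem_ofPred_eq]
  constructor
  · rintro ⟨t, ht, rfl⟩
    rw [← ofAdd_nsmul, ofAdd_eq_one, nsmul_eq_mul, mul_comm, ← ZMod.natCast_zmod_val t,
      ← Nat.cast_mul, ZMod.natCast_eq_zero_iff]
    exact ht
  · intro hx
    refine ⟨x.toAdd, ?_, rfl⟩
    rw [← ofAdd_toAdd x, ← ofAdd_nsmul, ofAdd_eq_one, nsmul_eq_mul, mul_comm,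
      ← ZMod.natCast_zmod_val (Multiplicative.toAdd x), ← Nat.cast_mul,
      ZMod.natCast_eq_zero_iff] at hx
    exact hx

theorem Nat.dvd_mul_finset_gcd_iff {ι : Type*} (S : Finset ι) (f : ι → ℕ) (m t : ℕ) :
    m ∣ t * S.gcd f ↔ ∀ j ∈ S, m ∣ t * f j := by
  rw [← Finset.dvd_gcd_iff, Finset.gcd_mul_left, normalize_eq]

/-- The number of solutions in `μ_n` of a system of equations `x ^ d = y`. -/
theorem rootsOfUnity.ncard_pow_eq {E : Type*} [Field E] {n : ℕ} [NeZero n]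
    (hE : Nat.card (rootsOfUnity n E) = n) (d : ℕ) (y : Eˣ) (hy : y ^ n = 1)
    [Decidable (y ^ (n / n.gcd d) = 1)] :
    {x : Eˣ | x ^ n = 1 ∧ x ^ d = y}.ncard = if y ^ (n / n.gcd d) = 1 then n.gcd d else 0 := by
  classical
  have h := IsCyclic.ncard_pow_eq (G := rootsOfUnity n E) d ⟨y, hy⟩
  rw [hE] at h
  simp only [Subtype.ext_iff, SubmonoidClass.coe_pow, OneMemClass.coe_one] at h
  rw [← h, ← Set.ncard_image_of_injective _ Subtype.val_injective]
  congr 1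
  ext x
  simp only [Set.mem_image, Set.mem_ofPred_eq]
  exact ⟨fun ⟨h1, h2⟩ => ⟨⟨x, h1⟩, h2, rfl⟩, fun ⟨⟨x', h1⟩, h2, h3⟩ => h3 ▸ ⟨h1, h2⟩⟩

/-- The number of solutions `a` in `μ_n` of a system `(a Z ^ x_j) ^ I_j = 1`. -/
theorem rootsOfUnity.ncard_forall_pow_eq {E ι : Type*} [Field E] {n : ℕ} [NeZero n]
    (hE : Nat.card (rootsOfUnity n E) = n) (Z : Eˣ) (S : Finset ι) (I : ι → ℕ)
    (x : ι → ℤ)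
    [Decidable ((∀ j ∈ S, (orderOf Z : ℤ) ∣ x j * (Nat.lcm n (I j) : ℕ)) ∧
      (∀ i ∈ S, ∀ j ∈ S, (orderOf Z : ℤ) ∣ (x j - x i) * (Nat.lcm (I i) (I j) : ℕ)))] :
    {a : Eˣ | a ^ n = 1 ∧ ∀ j ∈ S, (a * Z ^ x j) ^ I j = 1}.ncard =
      if (∀ j ∈ S, (orderOf Z : ℤ) ∣ x j * (Nat.lcm n (I j) : ℕ)) ∧
        (∀ i ∈ S, ∀ j ∈ S, (orderOf Z : ℤ) ∣ (x j - x i) * (Nat.lcm (I i) (I j) : ℕ))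
      then n.gcd (S.gcd I) else 0 := by
  have hn : 0 < n := Nat.pos_of_neZero n
  split_ifs with h
  · obtain ⟨h1, h2⟩ := h
    have c1 : ∀ j ∈ S, PowCompat n 1 (I j) (Z ^ (-x j * I j)) := fun j hj => by
      have := (powCompat_zpow_iff Z n (I j) 0 (-x j)).2 (by simpa using h1 j hj)
      simpa using this
    have c2 : ∀ i ∈ S, ∀ j ∈ S, PowCompat (I i) (Z ^ (-x i * I i)) (I j) (Z ^ (-x j * I j)) :=
      fun i hi j hj => (powCompat_zpow_iff Z (I i) (I j) _ _).2 (by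
        rw [show -x i - -x j = x j - x i by ring]; exact h2 i hi j hj)
    obtain ⟨v, hv, hc⟩ := PowCompat.merge_finset hn I (fun j => Z ^ (-x j * I j)) S c1 c2
    have hcn := hc n 1 (fun s t _ => by simp) fun j hj => (c1 j hj).symm
    set g := n.gcd (S.gcd I) with hg
    obtain ⟨e, he⟩ : g ∣ n := Nat.gcd_dvd_left _ _
    have hve : v ^ e = 1 := by
      have := hcn e 1 (by rw [one_mul, mul_comm]; exact_mod_cast he.symm)
      simpa using this
    have hgpos : 0 < g := Nat.gcd_pos_of_pos_left _ hn
    have hngg : n.gcd g = g := Nat.gcd_eq_right (Nat.gcd_dvd_left _ _)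
    classical
    have key := rootsOfUnity.ncard_pow_eq hE g v (by rw [he, mul_comm, pow_mul, hve, one_pow])
    rw [hngg, Nat.div_eq_of_eq_mul_right hgpos he, if_pos hve] at key
    rw [← key]
    congr 1
    ext a
    simp only [Set.mem_ofPred_eq, hv]
    have : ∀ j, (a * Z ^ x j) ^ I j = 1 ↔ a ^ I j = Z ^ (-x j * I j) := fun j => by
      rw [mul_pow, mul_eq_one_iff_eq_inv, neg_mul, zpow_neg, zpow_mul, zpow_natCast]
    simp only [this]
    tauto
  · rw [Set.eq_empty_of_forall_notMem (s := {a : Eˣ | _}), Set.ncard_empty]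
    rintro a ⟨ha, hj⟩
    have hpow : ∀ j ∈ S, ∀ L : ℕ, I j ∣ L → (a * Z ^ x j) ^ L = 1 := by
      rintro j hj' _ ⟨e, rfl⟩
      rw [pow_mul, hj j hj', one_pow]
    refine h ⟨fun j hj' => ?_, fun i hi j hj' => ?_⟩
    · have h1 := hpow j hj' _ (Nat.dvd_lcm_right n (I j))
      obtain ⟨e, he⟩ := Nat.dvd_lcm_left n (I j)
      have h2 : a ^ Nat.lcm n (I j) = 1 := by rw [he, pow_mul, ha, one_pow]
      rw [mul_pow, h2, one_mul, ← zpow_natCast, ← zpow_mul] at h1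
      exact orderOf_dvd_iff_zpow_eq_one.2 h1
    · have h1 := hpow i hi _ (Nat.dvd_lcm_left (I i) (I j))
      have h2 := hpow j hj' _ (Nat.dvd_lcm_right (I i) (I j))
      rw [mul_pow] at h1 h2
      have h3 := mul_left_cancel (h2.trans h1.symm)
      rw [← zpow_natCast, ← zpow_natCast, ← zpow_mul, ← zpow_mul, zpow_eq_zpow_iff_modEq,
        Int.modEq_comm, Int.modEq_iff_dvd] at h3
      rwa [sub_mul]

theorem rootsOfUnity.card_units_fintype {F E : Type*} [Field F] [Fintype F] [Field E]
    [Algebra F E] [NeZero (Fintype.card F - 1)] :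
    Nat.card (rootsOfUnity (Fintype.card F - 1) E) = Fintype.card F - 1 ∧
      ∀ a : Eˣ, a ^ (Fintype.card F - 1) = 1 ↔ ∃ b : Fˣ, Units.map (algebraMap F E) b = a := by
  classical
  have hinj : Function.Injective (Units.map (algebraMap F E : F →* E)) :=
    Units.map_injective (algebraMap F E).injective
  have hle : (Units.map (algebraMap F E : F →* E)).range ≤
      rootsOfUnity (Fintype.card F - 1) E := by
    rintro _ ⟨b, rfl⟩
    rw [mem_rootsOfUnity, ← map_pow, ← Fintype.card_units, pow_card_eq_one, map_one]
  have hcard : Nat.card (Units.map (algebraMap F E : F →* E)).range = Fintype.card F - 1 := by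
    rw [← Nat.card_congr (MonoidHom.ofInjective hinj).toEquiv, Nat.card_eq_fintype_card,
      Fintype.card_units]
  have heq := Subgroup.eq_of_le_of_card_ge hle (by rw [hcard]; exact card_rootsOfUnity _ _)
  refine ⟨by rw [← heq, hcard], fun a => ?_⟩
  rw [← mem_rootsOfUnity, ← heq]
  rfl

/-- The number of pairs `(a, t)` in `Fˣ × ZMod m` with `(a ζ ^ (i_j t)) ^ I_j = 1` for all `j`. -/
theorem sum_ncard_units_pow_eq_one {F E : Type*} [Field F] [Fintype F] [Field E] [Algebra F E]
    {m : ℕ} [NeZero m] {ζ : E} (hζ : IsPrimitiveRoot ζ m) {U : ℕ} (it I : Fin U → ℕ)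
    (S : Finset (Fin U)) :
    ∑ t : ZMod m, {a : Fˣ | ∀ j ∈ S, (algebraMap F E a * ζ ^ (it j * t.val)) ^ I j = 1}.ncard =
      m.gcd (Nat.gcd (S.gcd fun j => it j * Nat.lcm (Fintype.card F - 1) (I j))
        (((S ×ˢ S).filter fun p => p.1 < p.2).gcd fun p =>
          ((it p.2 : ℤ) - (it p.1 : ℤ)).natAbs * Nat.lcm (I p.1) (I p.2))) *
      (Fintype.card F - 1).gcd (S.gcd I) := by
  classical
  set n := Fintype.card F - 1 with hn
  have hn0 : NeZero n := ⟨by have := Fintype.one_lt_card (α := F); omega⟩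
  obtain ⟨hE, hF⟩ := rootsOfUnity.card_units_fintype (F := F) (E := E)
  set Z : Eˣ := (hζ.isUnit (NeZero.ne m)).unit with hZ
  have hZo : orderOf Z = m := by
    rw [← orderOf_units, hZ, IsUnit.unit_spec, ← hζ.eq_orderOf]
  set A := S.gcd fun j => it j * Nat.lcm n (I j) with hA
  set B := ((S ×ˢ S).filter fun p => p.1 < p.2).gcd fun p =>
          ((it p.2 : ℤ) - (it p.1 : ℤ)).natAbs * Nat.lcm (I p.1) (I p.2) with hB
  have hcond : ∀ t : ZMod m,
      ((∀ j ∈ S, (orderOf Z : ℤ) ∣ ((it j * t.val : ℕ) : ℤ) * (Nat.lcm n (I j) : ℕ)) ∧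
        (∀ i ∈ S, ∀ j ∈ S, (orderOf Z : ℤ) ∣
          (((it j * t.val : ℕ) : ℤ) - ((it i * t.val : ℕ) : ℤ)) * (Nat.lcm (I i) (I j) : ℕ))) ↔
      m ∣ t.val * A.gcd B := by
    intro t
    rw [hZo, ← Nat.gcd_mul_left, Nat.dvd_gcd_iff, hA, hB, Nat.dvd_mul_finset_gcd_iff,
      Nat.dvd_mul_finset_gcd_iff]
    have h2 : ∀ i j, (m : ℤ) ∣
        (((it j * t.val : ℕ) : ℤ) - ((it i * t.val : ℕ) : ℤ)) * (Nat.lcm (I i) (I j) : ℕ) ↔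
        m ∣ t.val * (((it j : ℤ) - (it i : ℤ)).natAbs * Nat.lcm (I i) (I j)) := by
      intro i j
      rw [← Int.natCast_dvd_natCast (m := m), ← Int.dvd_natAbs (b := (_ - _) * _), Int.natAbs_mul,
        Int.natAbs_natCast]
      congr! 2
      rw [← mul_assoc]
      congr 1
      push_cast
      rw [← sub_mul, Int.natAbs_mul, Int.natAbs_natCast, mul_comm]
    simp only [h2]
    refine and_congr ?_ ⟨?_, ?_⟩
    · refine forall₂_congr fun j _ => ?_
      rw [← Nat.cast_mul, Int.natCast_dvd_natCast]
      congr! 1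
      ring
    · intro h p hp
      simp only [Finset.mem_filter, Finset.mem_product] at hp
      exact h _ hp.1.1 _ hp.1.2
    · intro h i hi j hj
      rcases lt_trichotomy i j with hij | rfl | hij
      · exact h (i, j) (by simp [hi, hj, hij])
      · simp
      · have := h (j, i) (by simp [hi, hj, hij])
        rwa [← Int.natAbs_neg, neg_sub, Nat.lcm_comm] at this
  have hcount : ∀ t : ZMod m,
      {a : Fˣ | ∀ j ∈ S, (algebraMap F E a * ζ ^ (it j * t.val)) ^ I j = 1}.ncard =
        if m ∣ t.val * A.gcd B then n.gcd (S.gcd I) else 0 := by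
    intro t
    rw [← Set.ncard_image_of_injective _
      (Units.map_injective (f := (algebraMap F E : F →* E)) (algebraMap F E).injective)]
    have h := (rootsOfUnity.ncard_forall_pow_eq hE Z S I fun j => ((it j * t.val : ℕ) : ℤ)).trans
      (if_congr (hcond t) rfl rfl)
    rw [← h]
    congr 1
    ext a
    simp only [Set.mem_image, Set.mem_ofPred_eq, hF, zpow_natCast]
    have he : ∀ (b : Fˣ) (j : Fin U),
        (Units.map (algebraMap F E : F →* E) b * Z ^ (it j * t.val)) ^ I j = 1 ↔
        (algebraMap F E b * ζ ^ (it j * t.val)) ^ I j = 1 := by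
      intro b j
      rw [Units.ext_iff]
      simp [hZ]
    constructor
    · rintro ⟨b, hb, rfl⟩
      exact ⟨⟨b, rfl⟩, fun j hj => (he b j).2 (hb j hj)⟩
    · rintro ⟨⟨b, rfl⟩, hb⟩
      exact ⟨b, fun j hj => (he b j).1 (hb j hj), rfl⟩
  simp only [hcount]
  rw [← Finset.sum_filter, Finset.sum_const, smul_eq_mul, ← ZMod.ncard_dvd_val_mul m,
    Set.ncard_eq_toFinset_card']
  congr 2
  ext
  simp

/-- The number of fixed points of `x ↦ θ x ^ (q ^ r)` in the field of size `q ^ k`. -/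
theorem ncard_fixed_frobenius {E : Type*} [Field E] {q k : ℕ} (hq : 1 < q) (hk : 0 < k)
    (hK : {x : E | x ^ q ^ k = x}.ncard = q ^ k) (r : ℕ) {θ : E} (hθ₀ : θ ≠ 0)
    (hθ : θ ^ q ^ k = θ) [Decidable (θ ^ ((q ^ k - 1) / (q ^ k.gcd r - 1)) = 1)] :
    {x : E | x ^ q ^ k = x ∧ θ * x ^ q ^ r = x}.ncard =
      1 + if θ ^ ((q ^ k - 1) / (q ^ k.gcd r - 1)) = 1 then q ^ k.gcd r - 1 else 0 := by
  classical
  have hqk : 1 < q ^ k := Nat.one_lt_pow hk.ne' hq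
  have hqr : 0 < q ^ r := Nat.pow_pos (by omega)
  have hn0 : NeZero (q ^ k - 1) := ⟨by omega⟩
  have hpow : ∀ (x : E) (s : ℕ), x ≠ 0 → (x ^ q ^ s = x ↔ x ^ (q ^ s - 1) = 1) := by
    intro x s hx
    have : 0 < q ^ s := Nat.pow_pos (by omega)
    conv_lhs => rw [← Nat.sub_add_cancel this, pow_succ]
    exact mul_eq_right₀ hx
  have hfin : {x : E | x ^ q ^ k = x}.Finite := Set.finite_of_ncard_ne_zero (by omega)
  have hsplit : ∀ p : E → Prop, p 0 → {x : E | x ^ q ^ k = x ∧ p x}.ncard =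
      1 + {x : Eˣ | x ^ (q ^ k - 1) = 1 ∧ p x}.ncard := by
    intro p hp
    have : {x : E | x ^ q ^ k = x ∧ p x} =
        insert 0 (Units.val '' {x : Eˣ | x ^ (q ^ k - 1) = 1 ∧ p x}) := by
      ext x
      simp only [Set.mem_ofPred_eq, Set.mem_insert_iff, Set.mem_image]
      constructor
      · rintro ⟨h1, h2⟩
        by_cases hx : x = 0
        · exact Or.inl hx
        · refine Or.inr ⟨Units.mk0 x hx, ⟨?_, h2⟩, rfl⟩
          rw [Units.ext_iff]
          simpa using (hpow x k hx).1 h1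
      · rintro (rfl | ⟨y, ⟨h1, h2⟩, rfl⟩)
        · exact ⟨zero_pow (by omega), hp⟩
        · refine ⟨(hpow _ k y.ne_zero).2 ?_, h2⟩
          rw [Units.ext_iff] at h1
          simpa using h1
    have hfin' : {x : E | x ^ q ^ k = x ∧ p x}.Finite := hfin.subset fun x hx => hx.1
    rw [this] at hfin' ⊢
    rw [Set.ncard_insert_of_notMem (by simp) (hfin'.subset (Set.subset_insert _ _)),
      Set.ncard_image_of_injective _ Units.val_injective, add_comm]
  have hE : Nat.card (rootsOfUnity (q ^ k - 1) E) = q ^ k - 1 := by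
    have h := hsplit (fun _ => True) trivial
    simp only [and_true, hK] at h
    have h2 : Nat.card (rootsOfUnity (q ^ k - 1) E) =
      {x : Eˣ | x ^ (q ^ k - 1) = 1}.ncard := rfl
    omega
  rw [hsplit _ (by rw [zero_pow hqr.ne', mul_zero])]
  congr 1
  set T : Eˣ := Units.mk0 θ hθ₀ with hT
  have hTn : T⁻¹ ^ (q ^ k - 1) = 1 := by
    rw [inv_pow, inv_eq_one, Units.ext_iff]
    simpa [hT] using (hpow θ k hθ₀).1 hθ
  have h := rootsOfUnity.ncard_pow_eq hE (q ^ r - 1) T⁻¹ hTn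
  rw [Nat.pow_sub_one_gcd_pow_sub_one] at h
  have hc : T⁻¹ ^ ((q ^ k - 1) / (q ^ k.gcd r - 1)) = 1 ↔
      θ ^ ((q ^ k - 1) / (q ^ k.gcd r - 1)) = 1 := by
    rw [inv_pow, inv_eq_one, Units.ext_iff]
    simp [hT]
  simp only [hc] at h
  rw [← h]
  congr 1
  ext x
  simp only [Set.mem_ofPred_eq]
  refine and_congr_right fun _ => ?_
  have hx : (x : E) ^ q ^ r = x ^ (q ^ r - 1) * x := by
    rw [← pow_succ, Nat.sub_add_cancel hqr]
  rw [hx, ← mul_assoc, mul_eq_right₀ x.ne_zero, eq_inv_iff_mul_eq_one, mul_comm, Units.ext_iff]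
  simp [hT]

theorem MulAction.ncard_orbits_mul_card {G V : Type*} [Group G] [Fintype G] [MulAction G V]
    (X : Set V) (hfin : X.Finite) (hX : ∀ g : G, ∀ c ∈ X, g • c ∈ X) :
    {O : Set V | ∃ c ∈ X, O = MulAction.orbit G c}.ncard * Fintype.card G =
      ∑ g : G, {c | c ∈ X ∧ g • c = c}.ncard := by
  classical
  let Y : SubMulAction G V := ⟨X, fun g {c} hc => hX g c hc⟩
  have : Finite Y := hfin
  have := Fintype.ofFinite Y
  have h := MulAction.sum_card_fixedBy_eq_card_orbits_mul_card_group G Y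
  rw [← Nat.card_eq_fintype_card (α := Quotient _)] at h
  have horb : {O : Set V | ∃ c ∈ X, O = MulAction.orbit G c}.ncard =
      Nat.card (Quotient (MulAction.orbitRel G Y)) := by
    let φ : Quotient (MulAction.orbitRel G Y) → Set V :=
      Quotient.lift (fun c : Y => MulAction.orbit G (c : V)) fun a b hab => by
        obtain ⟨g, hg⟩ := MulAction.orbitRel_apply.1 hab
        have : g • (b : V) = a := congrArg Subtype.val hg
        exact MulAction.orbit_eq_iff.2 ⟨g, this⟩
    have hφ : Function.Injective φ := by
      intro a b
      induction a using Quotient.inductionOn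
      induction b using Quotient.inductionOn
      intro hab
      obtain ⟨g, hg⟩ := MulAction.orbit_eq_iff.1 hab
      exact Quotient.sound (MulAction.orbitRel_apply.2 ⟨g, Subtype.ext hg⟩)
    rw [← Set.ncard_univ, ← Set.ncard_image_of_injective _ hφ]
    congr 1
    ext O
    constructor
    · rintro ⟨c, hc, rfl⟩
      exact ⟨Quotient.mk _ ⟨c, hc⟩, trivial, rfl⟩
    · rintro ⟨a, -, rfl⟩
      induction a using Quotient.inductionOn with
      | h c => exact ⟨c, c.2, rfl⟩
  rw [horb, ← h]
  refine Finset.sum_congr rfl fun g _ => ?_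
  rw [← Nat.card_eq_fintype_card, Nat.card_coe_set_eq,
    ← Set.ncard_image_of_injective _ Subtype.val_injective]
  congr 1
  ext c
  constructor
  · rintro ⟨c, hc, rfl⟩
    exact ⟨c.2, congrArg Subtype.val hc⟩
  · rintro ⟨hc, hg⟩
    exact ⟨⟨c, hc⟩, Subtype.ext hg, rfl⟩

theorem cycCoset_eq_orbit {m : ℕ} [NeZero m] {q : ℕ} (u : (ZMod m)ˣ)
    (hu : (u : ZMod m) = q) (i : ℕ) :
    cycCoset q m i = MulAction.orbit (Subgroup.zpowers u) (i : ZMod m) := by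
  ext j
  constructor
  · rintro ⟨r, rfl⟩
    refine ⟨⟨u ^ r, r, by simp⟩, ?_⟩
    change ((u ^ r : (ZMod m)ˣ) : ZMod m) * _ = _
    rw [Units.val_pow_eq_pow_val, hu, mul_comm]
  · rintro ⟨⟨w, hw⟩, rfl⟩
    obtain ⟨r, rfl⟩ := (mem_powers_iff_mem_zpowers (x := u)).2 hw
    refine ⟨r, ?_⟩
    change ((u ^ r : (ZMod m)ˣ) : ZMod m) * _ = _
    rw [Units.val_pow_eq_pow_val, hu, mul_comm]

theorem pow_ncard_cycCoset_mul {m : ℕ} [NeZero m] {q : ℕ} (u : (ZMod m)ˣ)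
    (hu : (u : ZMod m) = q) (i : ℕ) :
    (q : ZMod m) ^ (cycCoset q m i).ncard * i = i := by
  classical
  have := Fintype.ofFinite (MulAction.orbit (Subgroup.zpowers u) (i : ZMod m))
  rw [cycCoset_eq_orbit u hu, ← Nat.card_coe_set_eq, Nat.card_eq_fintype_card,
    ← MulAction.minimalPeriod_eq_card]
  have h := Function.isPeriodicPt_minimalPeriod (u • · : ZMod m → ZMod m) (i : ZMod m)
  rw [Function.IsPeriodicPt, Function.IsFixedPt, smul_iterate] at h
  rw [← hu, ← Units.val_pow_eq_pow_val]
  exact h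

theorem cycCoset_eq_of_mem {m : ℕ} [NeZero m] {q : ℕ} (u : (ZMod m)ˣ)
    (hu : (u : ZMod m) = q) {i j : ℕ}
    (h : (j : ZMod m) ∈ cycCoset q m i) : cycCoset q m j = cycCoset q m i := by
  rw [cycCoset_eq_orbit u hu] at h
  rw [cycCoset_eq_orbit u hu, cycCoset_eq_orbit u hu]
  exact MulAction.orbit_eq_iff.2 h

theorem mem_cycCoset_self {m : ℕ} (q i : ℕ) : (i : ZMod m) ∈ cycCoset q m i := ⟨0, by simp⟩

theorem mul_mem_cycCoset_iff {m : ℕ} [NeZero m] {q : ℕ} (u : (ZMod m)ˣ)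
    (hu : (u : ZMod m) = q) (i : ℕ)
    (w : (ZMod m)ˣ) (hw : w ∈ Subgroup.zpowers u) (j : ZMod m) :
    ↑w * j ∈ cycCoset q m i ↔ j ∈ cycCoset q m i := by
  rw [cycCoset_eq_orbit u hu]
  rw [← MulAction.orbit_eq_iff, ← MulAction.orbit_eq_iff (a := j),
    ← MulAction.orbit_smul (⟨w, hw⟩ : Subgroup.zpowers u) j]
  rfl

section DFT

variable {F E : Type*} [Field F] [Field E] [Algebra F E] {m : ℕ} [NeZero m]

theorem IsPrimitiveRoot.pow_val_add {ζ : E} (hζ : IsPrimitiveRoot ζ m) (a b : ZMod m) :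
    ζ ^ (a + b).val = ζ ^ a.val * ζ ^ b.val :=
  AddChar.map_add_eq_mul (AddChar.zmodChar m hζ.pow_eq_one) a b

theorem IsPrimitiveRoot.pow_val_natCast_mul {ζ : E} (hζ : IsPrimitiveRoot ζ m) (n : ℕ)
    (a : ZMod m) : ζ ^ ((n : ZMod m) * a).val = ζ ^ (n * a.val) := by
  have := AddChar.zmodChar_apply' hζ.pow_eq_one (n * a.val)
  rwa [AddChar.zmodChar_apply, Nat.cast_mul, ZMod.natCast_zmod_val] at this

theorem evalDFT_injective {ζ : E} (hζ : IsPrimitiveRoot ζ m) {c d : ZMod m → F}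
    (h : ∀ j, evalDFT ζ c j = evalDFT ζ d j) : c = d := by
  have hinj : Function.Injective fun j : ZMod m => ζ ^ j.val := fun a b hab =>
    ZMod.val_injective m (hζ.pow_inj a.val_lt b.val_lt hab)
  let e : Fin m ≃ ZMod m := (ZMod.finEquiv m).toEquiv
  have he : ∀ i : Fin m, (e i).val = i := by
    intro i
    have := NeZero.ne m
    cases m with
    | zero => contradiction
    | succ n => rfl
  have h0 := Matrix.eq_zero_of_forall_index_sum_pow_mul_eq_zero
    (f := fun i : Fin m => ζ ^ (e i).val) (hinj.comp e.injective)
    (v := fun i : Fin m => algebraMap F E (c (e i)) - algebraMap F E (d (e i))) (by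
      intro j
      have := sub_eq_zero.2 (h (e j))
      rw [evalDFT, evalDFT, ← Finset.sum_sub_distrib, ← e.sum_comp] at this
      rw [← this]
      refine Finset.sum_congr rfl fun i _ => ?_
      have hx : ζ ^ (e i * e j).val = (ζ ^ (e j).val) ^ (i : ℕ) := by
        conv_lhs => rw [← ZMod.natCast_zmod_val (e i), hζ.pow_val_natCast_mul, he]
        rw [← pow_mul, mul_comm]
      rw [hx]
      ring)
  ext i
  have := congrFun h0 (e.symm i)
  simp only [Equiv.apply_symm_apply, Pi.zero_apply, sub_eq_zero] at this
  exact (algebraMap F E).injective this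

theorem evalDFT_cconv {ζ : E} (hζ : IsPrimitiveRoot ζ m) (g h : ZMod m → F) (j : ZMod m) :
    evalDFT ζ (cconv g h) j = evalDFT ζ g j * evalDFT ζ h j := by
  simp only [evalDFT, cconv, map_sum, map_mul, Finset.sum_mul, Finset.mul_sum]
  rw [Finset.sum_comm]
  conv_rhs => rw [Finset.sum_comm]
  refine Finset.sum_congr rfl fun i _ => ?_
  refine Fintype.sum_equiv (Equiv.subRight i) _ _ fun x => ?_
  have : x * j = i * j + (x - i) * j := by ring
  rw [this, hζ.pow_val_add, Equiv.subRight_apply]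
  ring

theorem evalDFT_sum {ι : Type*} (s : Finset ι) (ζ : E) (c : ι → ZMod m → F) (j : ZMod m) :
    evalDFT ζ (fun i => ∑ x ∈ s, c x i) j = ∑ x ∈ s, evalDFT ζ (c x) j := by
  simp only [evalDFT, map_sum, Finset.sum_mul]
  exact Finset.sum_comm

theorem evalDFT_affine {ζ : E} (hζ : IsPrimitiveRoot ζ m) (b : F) (t : ZMod m) (w : (ZMod m)ˣ)
    (h : ZMod m → F) (j : ZMod m) :
    evalDFT ζ (fun i => b * h (((w⁻¹ : (ZMod m)ˣ) : ZMod m) * (i - t))) j =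
      algebraMap F E b * ζ ^ (t * j).val * evalDFT ζ h (w * j) := by
  simp only [evalDFT, Finset.mul_sum]
  refine (Fintype.sum_equiv ((Units.mulLeft w).trans (Equiv.addRight t)) _ _ fun i => ?_).symm
  simp only [Equiv.trans_apply, Units.mulLeft_apply, Equiv.coe_addRight, add_sub_cancel_right,
    Units.inv_mul_cancel_left, map_mul]
  rw [add_mul, hζ.pow_val_add, mul_assoc (w : ZMod m), mul_left_comm i]
  ring

theorem evalDFT_pow_mul [Fintype F] {ζ : E} (hζ : IsPrimitiveRoot ζ m) (h : ZMod m → F) (r : ℕ)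
    (j : ZMod m) :
    evalDFT ζ h ((Fintype.card F : ZMod m) ^ r * j) = evalDFT ζ h j ^ Fintype.card F ^ r := by
  induction r with
  | zero => simp
  | succ r ih =>
    rw [pow_succ', mul_assoc, pow_succ, pow_mul, ← ih]
    rw [show ∀ x : E, x ^ Fintype.card F = FiniteField.frobeniusAlgHom F E x from fun _ => rfl]
    simp only [evalDFT, map_sum, map_mul, AlgHom.commutes]
    refine Finset.sum_congr rfl fun i _ => ?_
    rw [mul_left_comm, hζ.pow_val_natCast_mul, mul_comm (Fintype.card F), pow_mul]
    rfl

theorem inMinIdeal_affine {ζ : E} (hζ : IsPrimitiveRoot ζ m) {q : ℕ} {u : (ZMod m)ˣ}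
    (hu : (u : ZMod m) = q) {i : ℕ} (b : F) (t : ZMod m) {w : (ZMod m)ˣ}
    (hw : w ∈ Subgroup.zpowers u) {h : ZMod m → F} (hh : inMinIdeal q ζ i h) :
    inMinIdeal q ζ i fun x => b * h (((w⁻¹ : (ZMod m)ˣ) : ZMod m) * (x - t)) := by
  intro j hj
  rw [evalDFT_affine hζ, hh _ (by rwa [mul_mem_cycCoset_iff u hu i w hw]), mul_zero]

theorem inMinIdeal.ext [Fintype F] {ζ : E} (hζ : IsPrimitiveRoot ζ m) {i : ℕ} {g h : ZMod m → F}
    (hg : inMinIdeal (Fintype.card F) ζ i g) (hh : inMinIdeal (Fintype.card F) ζ i h)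
    (he : evalDFT ζ g i = evalDFT ζ h i) : g = h := by
  refine evalDFT_injective hζ fun j => ?_
  by_cases hj : j ∈ cycCoset (Fintype.card F) m i
  · obtain ⟨r, rfl⟩ := hj
    rw [mul_comm, evalDFT_pow_mul hζ, evalDFT_pow_mul hζ, he]
  · rw [hg j hj, hh j hj]

theorem ncard_pow_eq_self_le {q : ℕ} (hq : 1 < q) :
    {x : E | x ^ q = x}.Finite ∧ {x : E | x ^ q = x}.ncard ≤ q := by
  classical
  have h0 : (Polynomial.X ^ q - Polynomial.X : Polynomial E) ≠ 0 :=
    FiniteField.X_pow_card_sub_X_ne_zero E hq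
  have hsub : {x : E | x ^ q = x} ⊆
      ((Polynomial.X ^ q - Polynomial.X : Polynomial E).roots.toFinset : Set E) := by
    intro x hx
    simp only [Multiset.mem_toFinset, Finset.mem_coe, Polynomial.mem_roots h0,
      Polynomial.IsRoot.def, Polynomial.eval_sub, Polynomial.eval_pow, Polynomial.eval_X]
    exact sub_eq_zero.2 hx
  refine ⟨(Finset.finite_toSet _).subset hsub, ?_⟩
  calc _ ≤ _ := Set.ncard_le_ncard hsub (Finset.finite_toSet _)
    _ ≤ _ := by
      rw [Set.ncard_coe_finset]
      refine (Multiset.toFinset_card_le _).trans ((Polynomial.card_roots' _).trans ?_)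
      rw [FiniteField.X_pow_card_sub_X_natDegree_eq E hq]

end DFT

section MinimalIdeal

variable {F E : Type*} [Field F] [Fintype F] [Field E] [Algebra F E] {m : ℕ} [NeZero m]

theorem evalDFT_pow_card_cycCoset {ζ : E} (hζ : IsPrimitiveRoot ζ m) {u : (ZMod m)ˣ}
    (hu : (u : ZMod m) = Fintype.card F) (i : ℕ) (h : ZMod m → F) :
    evalDFT ζ h i ^ Fintype.card F ^ (cycCoset (Fintype.card F) m i).ncard = evalDFT ζ h i := by
  rw [← evalDFT_pow_mul hζ, pow_ncard_cycCoset_mul u hu]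

theorem ncard_inMinIdeal_le {ζ : E} (hζ : IsPrimitiveRoot ζ m) {u : (ZMod m)ˣ}
    (hu : (u : ZMod m) = Fintype.card F) (i : ℕ) {k : ℕ}
    (hk : (cycCoset (Fintype.card F) m i).ncard = k) (hk0 : 0 < k) :
    {h : ZMod m → F | inMinIdeal (Fintype.card F) ζ i h}.ncard ≤ Fintype.card F ^ k := by
  obtain ⟨hfin, hle⟩ := ncard_pow_eq_self_le (E := E)
    (Nat.one_lt_pow hk0.ne' (Fintype.one_lt_card (α := F)))
  refine le_trans (Set.ncard_le_ncard_of_injOn (fun h => evalDFT ζ h i) ?_ ?_ hfin) hle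
  · intro h _
    have := evalDFT_pow_card_cycCoset hζ hu i h
    rwa [hk] at this
  · exact fun g hg h hh he => inMinIdeal.ext hζ hg hh he

/-- The number of fixed points of an affine map composed with a scalar on a minimal ideal. -/
theorem ncard_inMinIdeal_fixed {ζ : E} (hζ : IsPrimitiveRoot ζ m) {u : (ZMod m)ˣ}
    (hu : (u : ZMod m) = Fintype.card F) (i : ℕ) {k : ℕ}
    (hk : (cycCoset (Fintype.card F) m i).ncard = k) (hk0 : 0 < k)
    (hcard : {h : ZMod m → F | inMinIdeal (Fintype.card F) ζ i h}.ncard = Fintype.card F ^ k)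
    (b : Fˣ) (t : ZMod m) (r : ℕ)
    [Decidable ((algebraMap F E b * ζ ^ (i * t.val)) ^ Ifac (Fintype.card F) k r = 1)] :
    {h : ZMod m → F | inMinIdeal (Fintype.card F) ζ i h ∧
        (fun x => (b : F) * h ((((u ^ r)⁻¹ : (ZMod m)ˣ) : ZMod m) * (x - t))) = h}.ncard =
      1 + if (algebraMap F E b * ζ ^ (i * t.val)) ^ Ifac (Fintype.card F) k r = 1
        then Fintype.card F ^ k.gcd r - 1 else 0 := by
  have hq : 1 < Fintype.card F := Fintype.one_lt_card
  obtain ⟨hfin, hle⟩ := ncard_pow_eq_self_le (E := E) (Nat.one_lt_pow hk0.ne' hq)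
  set W := {h : ZMod m → F | inMinIdeal (Fintype.card F) ζ i h} with hW
  have hinj : Set.InjOn (fun h : ZMod m → F => evalDFT ζ h i) W :=
    fun g hg h hh he => inMinIdeal.ext hζ hg hh he
  have hsub : (fun h : ZMod m → F => evalDFT ζ h i) '' W ⊆
      {x : E | x ^ Fintype.card F ^ k = x} := by
    rintro _ ⟨h, _, rfl⟩
    have := evalDFT_pow_card_cycCoset hζ hu i h
    rwa [hk] at this
  have himg : (fun h : ZMod m → F => evalDFT ζ h i) '' W = {x : E | x ^ Fintype.card F ^ k = x} :=
    Set.eq_of_subset_of_ncard_le hsub (by rw [hinj.ncard_image, hcard]; exact hle) hfin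
  have hK : {x : E | x ^ Fintype.card F ^ k = x}.ncard = Fintype.card F ^ k := by
    rw [← himg, hinj.ncard_image, hcard]
  have hζi : (ζ ^ (i * t.val)) ^ Fintype.card F ^ k = ζ ^ (i * t.val) := by
    have h1 := pow_ncard_cycCoset_mul u hu i
    rw [hk] at h1
    rw [← pow_mul, mul_comm, ← mul_assoc]
    have h2 := hζ.pow_val_natCast_mul (Fintype.card F ^ k * i) t
    have h3 := hζ.pow_val_natCast_mul i t
    rw [← h2, ← h3, Nat.cast_mul, Nat.cast_pow, h1]
  have hθ : (algebraMap F E b * ζ ^ (i * t.val)) ^ Fintype.card F ^ k =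
      algebraMap F E b * ζ ^ (i * t.val) := by
    rw [mul_pow, hζi, ← map_pow, FiniteField.pow_card_pow]
  have hθ0 : algebraMap F E b * ζ ^ (i * t.val) ≠ 0 :=
    mul_ne_zero (by simp) (pow_ne_zero _ (hζ.ne_zero (NeZero.ne m)))
  refine Eq.trans ?_ (@ncard_fixed_frobenius E _ _ _ hq hk0 hK r _ hθ0 hθ ‹_›)
  rw [← (hinj.mono fun h hh => hh.1).ncard_image]
  congr 1
  have hev : ∀ h : ZMod m → F,
      evalDFT ζ (fun x => (b : F) * h ((((u ^ r)⁻¹ : (ZMod m)ˣ) : ZMod m) * (x - t))) i =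
        algebraMap F E b * ζ ^ (i * t.val) * evalDFT ζ h i ^ Fintype.card F ^ r := by
    intro h
    rw [evalDFT_affine hζ, mul_comm t, hζ.pow_val_natCast_mul, Units.val_pow_eq_pow_val, hu,
      evalDFT_pow_mul hζ]
  ext x
  simp only [Set.mem_image, Set.mem_ofPred_eq]
  constructor
  · rintro ⟨h, ⟨h1, h2⟩, rfl⟩
    refine ⟨hsub ⟨h, h1, rfl⟩, ?_⟩
    rw [← hev, h2]
  · rintro ⟨h1, h2⟩
    have hx : x ∈ (fun h : ZMod m → F => evalDFT ζ h i) '' W := by rw [himg]; exact h1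
    obtain ⟨h, hh, rfl⟩ := hx
    refine ⟨h, ⟨hh, ?_⟩, rfl⟩
    refine inMinIdeal.ext hζ (inMinIdeal_affine hζ hu (b : F) t
      (Subgroup.pow_mem _ (Subgroup.mem_zpowers u) r) hh) hh ?_
    rw [hev]
    exact h2

end MinimalIdeal

/-- The group `⟨μ_q, ρ^l, M⟩` as an abstract group: triples acting on `F^{lm}` by
`c ↦ ((i, j) ↦ b * c (w⁻¹ (i - t), j))`. -/
@[ext]
structure AffineScalar (F : Type*) [Field F] {m : ℕ} (u : (ZMod m)ˣ) where
  shift : ZMod m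
  mult : Subgroup.zpowers u
  scalar : Fˣ

namespace AffineScalar

variable {F : Type*} [Field F] {m : ℕ} {u : (ZMod m)ˣ}

/-- The components of an element. -/
def equivProd : AffineScalar F u ≃ ZMod m × Subgroup.zpowers u × Fˣ where
  toFun g := (g.shift, g.mult, g.scalar)
  invFun p := ⟨p.1, p.2.1, p.2.2⟩
  left_inv _ := rfl
  right_inv _ := rfl

instance : Mul (AffineScalar F u) :=
  ⟨fun g h => ⟨g.shift + (g.mult : (ZMod m)ˣ) * h.shift, g.mult * h.mult, g.scalar * h.scalar⟩⟩

instance : One (AffineScalar F u) := ⟨⟨0, 1, 1⟩⟩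

instance : Inv (AffineScalar F u) :=
  ⟨fun g => ⟨-(((g.mult : (ZMod m)ˣ)⁻¹ : (ZMod m)ˣ) * g.shift), g.mult⁻¹, g.scalar⁻¹⟩⟩

theorem mul_def (g h : AffineScalar F u) : g * h =
    ⟨g.shift + (g.mult : (ZMod m)ˣ) * h.shift, g.mult * h.mult, g.scalar * h.scalar⟩ := rfl

theorem one_def : (1 : AffineScalar F u) = ⟨0, 1, 1⟩ := rfl

theorem inv_def (g : AffineScalar F u) : g⁻¹ =
    ⟨-(((g.mult : (ZMod m)ˣ)⁻¹ : (ZMod m)ˣ) * g.shift), g.mult⁻¹, g.scalar⁻¹⟩ := rfl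

instance : Group (AffineScalar F u) :=
  Group.ofLeftAxioms
    (fun a b c => by
      simp only [mul_def, AffineScalar.mk.injEq, mul_assoc, and_true]
      push_cast
      ring)
    (fun a => by simp [mul_def, one_def])
    (fun a => by simp [mul_def, one_def, inv_def])

instance (ι : Type*) : MulAction (AffineScalar F u) (ZMod m × ι → F) where
  smul g c := fun p => g.scalar * c (((g.mult : (ZMod m)ˣ)⁻¹ : (ZMod m)ˣ) * (p.1 - g.shift), p.2)
  one_smul c := by
    funext p
    change ((1 : Fˣ) : F) * c ((((1 : Subgroup.zpowers u) : (ZMod m)ˣ)⁻¹ : (ZMod m)ˣ) *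
      (p.1 - 0), p.2) = c p
    simp
  mul_smul g h c := by
    funext p
    change (↑(g.scalar * h.scalar) : F) *
        c ((((g.mult * h.mult : Subgroup.zpowers u) : (ZMod m)ˣ)⁻¹ : (ZMod m)ˣ) *
          (p.1 - (g.shift + (g.mult : (ZMod m)ˣ) * h.shift)), p.2) =
      g.scalar * (h.scalar * c (((h.mult : (ZMod m)ˣ)⁻¹ : (ZMod m)ˣ) *
        (((g.mult : (ZMod m)ˣ)⁻¹ : (ZMod m)ˣ) * (p.1 - g.shift) - h.shift), p.2))
    have : ((((g.mult * h.mult : Subgroup.zpowers u) : (ZMod m)ˣ)⁻¹ : (ZMod m)ˣ) : ZMod m) *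
          (p.1 - (g.shift + (g.mult : (ZMod m)ˣ) * h.shift)) =
        ((h.mult : (ZMod m)ˣ)⁻¹ : (ZMod m)ˣ) *
        (((g.mult : (ZMod m)ˣ)⁻¹ : (ZMod m)ˣ) * (p.1 - g.shift) - h.shift) := by
      have hg : (((g.mult : (ZMod m)ˣ)⁻¹ : (ZMod m)ˣ) : ZMod m) * (g.mult : (ZMod m)ˣ) = 1 :=
        Units.inv_mul _
      rw [Subgroup.coe_mul, mul_inv, Units.val_mul]
      linear_combination (-(((h.mult : (ZMod m)ˣ)⁻¹ : (ZMod m)ˣ) : ZMod m) * h.shift) * hg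
    rw [this, Units.val_mul, mul_assoc]

theorem smul_apply {ι : Type*} (g : AffineScalar F u) (c : ZMod m × ι → F) (p : ZMod m × ι) :
    (g • c) p = g.scalar * c (((g.mult : (ZMod m)ˣ)⁻¹ : (ZMod m)ˣ) * (p.1 - g.shift), p.2) := rfl

end AffineScalar

theorem LinearEquiv.zpow_apply_eq_comp {F X : Type*} [Field F] (f : (X → F) ≃ₗ[F] (X → F))
    (φ : ℤ → X → X) (h0 : ∀ x, φ 0 x = x) (hadd : ∀ i j x, φ (i + j) x = φ i (φ j x))
    (h1 : ∀ c, f c = c ∘ φ 1) (n : ℤ) (c : X → F) : (f ^ n) c = c ∘ φ n := by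
  have hinv : ∀ c, f⁻¹ c = c ∘ φ (-1) := by
    intro c
    have : f (c ∘ φ (-1)) = c := by
      rw [h1]
      funext x
      simp only [Function.comp_apply, ← hadd, neg_add_cancel, h0]
    conv_lhs => rw [← this]
    exact f.symm_apply_apply _
  induction n using Int.induction_on generalizing c with
  | zero => funext x; simp [h0]
  | succ n ih =>
    rw [zpow_add_one, LinearEquiv.mul_apply, ih, h1]
    funext x
    simp only [Function.comp_apply, ← hadd, add_comm]
  | pred n ih =>
    rw [zpow_sub_one, LinearEquiv.mul_apply, ih, hinv]
    funext x
    simp only [Function.comp_apply, ← hadd, sub_eq_add_neg, add_comm]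

theorem shiftQC_zpow_apply {F : Type*} [Field F] {m l : ℕ} (n : ℤ) (c : ZMod m × Fin l → F)
    (p : ZMod m × Fin l) : (shiftQC F m l ^ n) c p = c (p.1 - n, p.2) := by
  rw [LinearEquiv.zpow_apply_eq_comp (shiftQC F m l) (fun n p => (p.1 - (n : ZMod m), p.2))
    (by simp) (fun i j x => by simp only [Int.cast_add, Prod.mk.injEq, and_true]; ring)
    (fun c => by funext p; simp [shiftQC, LinearEquiv.funCongrLeft_apply, LinearMap.funLeft]; rfl)]
  rfl

theorem multiplierQC_zpow_apply {F : Type*} [Field F] {m l : ℕ} (u : (ZMod m)ˣ) (n : ℤ)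
    (c : ZMod m × Fin l → F) (p : ZMod m × Fin l) :
    (multiplierQC F m l u ^ n) c p = c (((u ^ n)⁻¹ : (ZMod m)ˣ) * p.1, p.2) := by
  rw [LinearEquiv.zpow_apply_eq_comp (multiplierQC F m l u)
    (fun n p => ((((u ^ n)⁻¹ : (ZMod m)ˣ) : ZMod m) * p.1, p.2)) (by simp)
    (fun i j x => by
      simp only [zpow_add, mul_inv, Units.val_mul, Prod.mk.injEq, and_true]; ring)
    (fun c => by
      funext p
      simp [multiplierQC, LinearEquiv.funCongrLeft_apply, LinearMap.funLeft]; rfl)]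
  rfl

theorem AffineScalar.orbit_eq {F : Type*} [Field F] {m l : ℕ} [NeZero m] (u : (ZMod m)ˣ)
    (c : ZMod m × Fin l → F) :
    {x | ∃ (r₁ r₂ : ℤ) (b : Fˣ),
        (multiplierQC F m l u ^ r₁) ((shiftQC F m l ^ r₂) ((b : F) • c)) = x} =
      MulAction.orbit (AffineScalar F u) c := by
  have key : ∀ (r₁ r₂ : ℤ) (b : Fˣ),
      (multiplierQC F m l u ^ r₁) ((shiftQC F m l ^ r₂) ((b : F) • c)) =
        (⟨((u ^ r₁ : (ZMod m)ˣ) : ZMod m) * r₂, ⟨u ^ r₁, r₁, rfl⟩, b⟩ : AffineScalar F u) • c := by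
    intro r₁ r₂ b
    funext p
    rw [multiplierQC_zpow_apply, shiftQC_zpow_apply, AffineScalar.smul_apply, Pi.smul_apply,
      smul_eq_mul, mul_sub, Units.inv_mul_cancel_left]
  ext x
  constructor
  · rintro ⟨r₁, r₂, b, rfl⟩
    exact ⟨_, (key r₁ r₂ b).symm⟩
  · rintro ⟨⟨t, ⟨_, r₁, rfl⟩, b⟩, rfl⟩
    obtain ⟨r₂, hr₂⟩ := ZMod.intCast_surjective ((((u ^ r₁)⁻¹ : (ZMod m)ˣ) : ZMod m) * t)
    refine ⟨r₁, r₂, b, ?_⟩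
    rw [key, hr₂, Units.mul_inv_cancel_left]

theorem Set.ncard_forall_mem {ι : Type*} [Fintype ι] {β : ι → Type*} (A : ∀ i, Set (β i)) :
    {b : ∀ i, β i | ∀ i, b i ∈ A i}.ncard = ∏ i, (A i).ncard := by
  have h := Nat.card_congr (Equiv.Set.univPi A)
  rw [Nat.card_pi, Nat.card_coe_set_eq] at h
  simp only [Nat.card_coe_set_eq] at h
  rw [← h]
  congr 1
  ext b
  simp

theorem AffineScalar.sum_eq {F : Type*} [Field F] [Fintype F] {m : ℕ} [NeZero m] (u : (ZMod m)ˣ)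
    [Fintype (AffineScalar F u)] [Fintype Fˣ] (φ : AffineScalar F u → ℕ) :
    ∑ g, φ g = ∑ r ∈ Finset.range (orderOf u), ∑ t : ZMod m, ∑ b : Fˣ,
      φ ⟨t, ⟨u ^ r, Subgroup.pow_mem _ (Subgroup.mem_zpowers u) r⟩, b⟩ := by
  classical
  have := Fintype.ofFinite (Subgroup.zpowers u)
  rw [← AffineScalar.equivProd.symm.sum_comp]
  simp only [Fintype.sum_prod_type]
  rw [Finset.sum_comm, Finset.sum_range,
    ← (finEquivZPowers (isOfFinOrder_of_finite u)).sum_comp]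
  rfl

theorem AffineScalar.card_eq {F : Type*} [Field F] [Fintype F] {m : ℕ} [NeZero m] (u : (ZMod m)ˣ)
    [Fintype (AffineScalar F u)] :
    Fintype.card (AffineScalar F u) = orderOf u * m * (Fintype.card F - 1) := by
  classical
  rw [← Nat.card_eq_fintype_card, Nat.card_congr AffineScalar.equivProd, Nat.card_prod,
    Nat.card_prod, Nat.card_zpowers, Nat.card_zmod, Nat.card_eq_fintype_card, Fintype.card_units]
  ring

/-- The codeword with components `Σ_j s_j h_j`. -/
def combineColumns {F : Type*} [Field F] {m : ℕ} {ι κ : Type*} [Fintype κ] (s : κ → ι → F)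
    (h : κ → ZMod m → F) : ZMod m × ι → F :=
  fun p => ∑ j, s j p.2 * h j p.1

theorem AffineScalar.smul_combineColumns {F : Type*} [Field F] {m : ℕ} {ι κ : Type*}
    [Fintype κ] {u : (ZMod m)ˣ} (g : AffineScalar F u) (s : κ → ι → F) (h : κ → ZMod m → F) :
    g • combineColumns s h = combineColumns s fun j x =>
      g.scalar * h j ((((g.mult : (ZMod m)ˣ)⁻¹ : (ZMod m)ˣ) : ZMod m) * (x - g.shift)) := by
  funext p
  rw [AffineScalar.smul_apply]
  simp only [combineColumns, Finset.mul_sum]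
  exact Finset.sum_congr rfl fun j _ => mul_left_comm _ _ _

section Codewords

variable {F E : Type*} [Field F] [Fintype F] [Field E] [Algebra F E] {m : ℕ} [NeZero m]

/-- A one-dimensional code over a minimal ideal whose generator entries are `0` or `f` consists of
the multiples of a scalar vector by elements of the ideal. -/
theorem exists_scalars_of_generator {ζ : E} (hζ : IsPrimitiveRoot ζ m) {u : (ZMod m)ˣ}
    (hu : (u : ZMod m) = Fintype.card F) {i k : ℕ}
    (hk : (cycCoset (Fintype.card F) m i).ncard = k) (hk0 : 0 < k) {ι : Type*} {f : ZMod m → F}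
    (a : ι → ZMod m → F) (ha : ∀ v, a v = 0 ∨ a v = f)
    (hcard : {c : ZMod m × ι → F | ∃ g : ZMod m → F, inMinIdeal (Fintype.card F) ζ i g ∧
      ∀ x v, c (x, v) = cconv g (a v) x}.ncard = Fintype.card F ^ k) :
    {h : ZMod m → F | inMinIdeal (Fintype.card F) ζ i h}.ncard = Fintype.card F ^ k ∧
      ∃ s : ι → F, (∃ v, s v ≠ 0) ∧
        {c : ZMod m × ι → F | ∃ g : ZMod m → F, inMinIdeal (Fintype.card F) ζ i g ∧
          ∀ x v, c (x, v) = cconv g (a v) x} =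
        (fun h p => s p.2 * h p.1) '' {h : ZMod m → F | inMinIdeal (Fintype.card F) ζ i h} := by
  classical
  set D := {c : ZMod m × ι → F | ∃ g : ZMod m → F, inMinIdeal (Fintype.card F) ζ i g ∧
      ∀ x v, c (x, v) = cconv g (a v) x} with hD
  set W := {h : ZMod m → F | inMinIdeal (Fintype.card F) ζ i h} with hW
  set s : ι → F := fun v => if a v = 0 then 0 else 1 with hs
  have hWfin : W.Finite := Set.toFinite W
  have hsub : D ⊆ (fun h p => s p.2 * h p.1) '' W := by
    rintro c ⟨g, hg, hc⟩
    refine ⟨cconv g f, fun j hj => by rw [evalDFT_cconv hζ, hg j hj, zero_mul], ?_⟩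
    funext ⟨x, v⟩
    rw [hc, hs]
    dsimp only
    split_ifs with h0
    · simp [h0, cconv]
    · rw [(ha v).resolve_left h0, one_mul]
  have hle : W.ncard ≤ _ := ncard_inMinIdeal_le (E := E) hζ hu i hk hk0
  have h1 := Set.ncard_le_ncard hsub (hWfin.image _)
  have h2 := Set.ncard_image_le (f := fun (h : ZMod m → F) (p : ZMod m × ι) => s p.2 * h p.1) hWfin
  have heq := Set.eq_of_subset_of_ncard_le hsub (by omega) (hWfin.image _)
  refine ⟨by omega, s, ?_, heq⟩
  by_contra! hz
  have h3 : D ⊆ {0} := by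
    rw [heq]
    rintro _ ⟨h, -, rfl⟩
    funext p
    simp [hz]
  have h4 := Set.ncard_le_ncard h3
  rw [hcard, Set.ncard_singleton] at h4
  exact absurd (Nat.one_lt_pow hk0.ne' (Fintype.one_lt_card (α := F))) (by omega)

variable {ι κ : Type*} [Fintype κ]

theorem combineColumns_injOn {ζ : E} (hζ : IsPrimitiveRoot ζ m) {u : (ZMod m)ˣ}
    (hu : (u : ZMod m) = Fintype.card F) {it : κ → ℕ}
    (hdist : ∀ j j', j ≠ j' →
      cycCoset (Fintype.card F) m (it j) ≠ cycCoset (Fintype.card F) m (it j'))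
    {s : κ → ι → F} (hs : ∀ j, ∃ v, s j v ≠ 0) :
    Set.InjOn (combineColumns (m := m) s)
      {h | ∀ j, inMinIdeal (Fintype.card F) ζ (it j) (h j)} := by
  classical
  intro g hg h hh he
  funext j
  refine inMinIdeal.ext hζ (hg j) (hh j) ?_
  obtain ⟨v, hv⟩ := hs j
  have key : ∀ b : κ → ZMod m → F, (∀ j, inMinIdeal (Fintype.card F) ζ (it j) (b j)) →
      evalDFT ζ (fun x => combineColumns s b (x, v)) (it j) =
        algebraMap F E (s j v) * evalDFT ζ (b j) (it j) := by
    intro b hb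
    have hmul : ∀ j' x, evalDFT ζ (fun y => s j' v * b j' y) x =
        algebraMap F E (s j' v) * evalDFT ζ (b j') x := by
      intro j' x
      simp only [evalDFT, map_mul, Finset.mul_sum, mul_assoc]
    simp only [combineColumns, evalDFT_sum, hmul]
    refine Finset.sum_eq_single j (fun j' _ hj' => ?_) (by simp)
    rw [hb j', mul_zero]
    exact fun hmem => hdist j j' hj'.symm (cycCoset_eq_of_mem u hu hmem)
  have h1 := key g hg
  rw [he, key h hh] at h1
  exact (mul_left_cancel₀ (by simpa using hv) h1).symm

theorem AffineScalar.ncard_fixed_combineColumns {ζ : E} (hζ : IsPrimitiveRoot ζ m)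
    {u : (ZMod m)ˣ} (hu : (u : ZMod m) = Fintype.card F) {it : κ → ℕ}
    (hdist : ∀ j j', j ≠ j' →
      cycCoset (Fintype.card F) m (it j) ≠ cycCoset (Fintype.card F) m (it j'))
    {s : κ → ι → F} (hs : ∀ j, ∃ v, s j v ≠ 0) (g : AffineScalar F u) :
    {c | c ∈ combineColumns (m := m) s ''
        {h | ∀ j, inMinIdeal (Fintype.card F) ζ (it j) (h j)} ∧ g • c = c}.ncard =
      ∏ j, {h : ZMod m → F | inMinIdeal (Fintype.card F) ζ (it j) h ∧ (fun x => (g.scalar : F) *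
        h ((((g.mult : (ZMod m)ˣ)⁻¹ : (ZMod m)ˣ) : ZMod m) * (x - g.shift))) = h}.ncard := by
  have hinj := combineColumns_injOn (F := F) hζ hu hdist hs
  rw [← Set.ncard_forall_mem, ← (hinj.mono fun h hh j => (hh j).1).ncard_image]
  congr 1
  ext c
  constructor
  · rintro ⟨⟨h, hh, rfl⟩, hc⟩
    rw [AffineScalar.smul_combineColumns] at hc
    have := hinj (fun j => inMinIdeal_affine hζ hu _ _ g.mult.2 (hh j)) hh hc
    exact ⟨h, fun j => ⟨hh j, congrFun this j⟩, rfl⟩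
  · rintro ⟨h, hh, rfl⟩
    refine ⟨⟨h, fun j => (hh j).1, rfl⟩, ?_⟩
    rw [AffineScalar.smul_combineColumns]
    exact congrArg _ (funext fun j => (hh j).2)

end Codewords

theorem AffineScalar.hammingNorm_smul {F : Type*} [Field F] [DecidableEq F] {m : ℕ} [NeZero m]
    {u : (ZMod m)ˣ} {ι : Type*} [Fintype ι] (g : AffineScalar F u) (c : ZMod m × ι → F) :
    hammingNorm (g • c) = hammingNorm c := by
  refine Finset.card_equiv (((Equiv.subRight g.shift).trans
    (Units.mulLeft (g.mult : (ZMod m)ˣ)⁻¹)).prodCongr (Equiv.refl ι)) fun p => ?_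
  simp only [Finset.mem_filter, Finset.mem_univ, true_and, AffineScalar.smul_apply, ne_eq,
    mul_eq_zero, Units.ne_zero, false_or]
  rfl

section OrbitCount

variable {F E : Type*} [Field F] [Fintype F] [Field E] [Algebra F E] {m : ℕ} [NeZero m]
  {ι : Type*} [Finite ι] {U : ℕ}

theorem AffineScalar.ncard_fixed_ne_zero {ζ : E} (hζ : IsPrimitiveRoot ζ m)
    {u : (ZMod m)ˣ} (hu : (u : ZMod m) = Fintype.card F) {it k : Fin U → ℕ}
    (hdist : ∀ j j', j ≠ j' →
      cycCoset (Fintype.card F) m (it j) ≠ cycCoset (Fintype.card F) m (it j'))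
    (hk : ∀ j, (cycCoset (Fintype.card F) m (it j)).ncard = k j) (hk0 : ∀ j, 0 < k j)
    (hcard : ∀ j, {h : ZMod m → F | inMinIdeal (Fintype.card F) ζ (it j) h}.ncard =
      Fintype.card F ^ k j)
    {s : Fin U → ι → F} (hs : ∀ j, ∃ v, s j v ≠ 0)
    (b : Fˣ) (t : ZMod m) (r : ℕ)
    [∀ j, Decidable ((algebraMap F E b * ζ ^ (it j * t.val)) ^ Ifac (Fintype.card F) (k j) r = 1)] :
    {c | (c ∈ combineColumns (m := m) s ''
        {h | ∀ j, inMinIdeal (Fintype.card F) ζ (it j) (h j)} ∧ c ≠ 0) ∧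
      (⟨t, ⟨u ^ r, Subgroup.pow_mem _ (Subgroup.mem_zpowers u) r⟩, b⟩ : AffineScalar F u) • c =
        c}.ncard =
      ∑ S : Finset (Fin U) with S.Nonempty,
        if ∀ j ∈ S, (algebraMap F E b * ζ ^ (it j * t.val)) ^ Ifac (Fintype.card F) (k j) r = 1
        then ∏ j ∈ S, (Fintype.card F ^ (k j).gcd r - 1) else 0 := by
  classical
  set g : AffineScalar F u := ⟨t, ⟨u ^ r, Subgroup.pow_mem _ (Subgroup.mem_zpowers u) r⟩, b⟩
  set X := combineColumns (m := m) s '' {h | ∀ j, inMinIdeal (Fintype.card F) ζ (it j) (h j)}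
  have h1 := AffineScalar.ncard_fixed_combineColumns hζ hu hdist hs g
  have h2 : ∀ j, {h : ZMod m → F | inMinIdeal (Fintype.card F) ζ (it j) h ∧
      (fun x => (g.scalar : F) *
        h ((((g.mult : (ZMod m)ˣ)⁻¹ : (ZMod m)ˣ) : ZMod m) * (x - g.shift))) = h}.ncard = _ :=
    fun j => ncard_inMinIdeal_fixed hζ hu (it j) (hk j) (hk0 j) (hcard j) b t r
  simp only [h2, Finset.prod_one_add, Finset.prod_ite_zero, Finset.powerset_univ] at h1
  rw [← Finset.sum_filter_add_sum_filter_not _ fun S : Finset (Fin U) => S.Nonempty] at h1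
  have h3 : (Finset.univ.filter fun S : Finset (Fin U) => ¬ S.Nonempty) = {∅} := by
    ext S; simp
  rw [h3, Finset.sum_singleton] at h1
  simp only [Finset.notMem_empty, false_imp_iff, implies_true, if_true, Finset.prod_empty] at h1
  have h4 : {c | c ∈ X ∧ g • c = c} = insert 0 {c | (c ∈ X ∧ c ≠ 0) ∧ g • c = c} := by
    ext c
    simp only [Set.mem_ofPred_eq, Set.mem_insert_iff]
    constructor
    · rintro ⟨hc, hg⟩
      by_cases h0 : c = 0
      · exact Or.inl h0
      · exact Or.inr ⟨⟨hc, h0⟩, hg⟩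
    · rintro (rfl | ⟨⟨hc, -⟩, hg⟩)
      · refine ⟨⟨0, fun j i _ => by simp [evalDFT], ?_⟩, ?_⟩
        · funext p
          simp [combineColumns]
        · funext p
          simp [AffineScalar.smul_apply]
      · exact ⟨hc, hg⟩
  rw [h4, Set.ncard_insert_of_notMem (by simp) (Set.toFinite _)] at h1
  convert Nat.succ_injective h1

theorem AffineScalar.ncard_orbits_mul {ζ : E} (hζ : IsPrimitiveRoot ζ m)
    {u : (ZMod m)ˣ} (hu : (u : ZMod m) = Fintype.card F) {it k : Fin U → ℕ}
    (hdist : ∀ j j', j ≠ j' →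
      cycCoset (Fintype.card F) m (it j) ≠ cycCoset (Fintype.card F) m (it j'))
    (hk : ∀ j, (cycCoset (Fintype.card F) m (it j)).ncard = k j) (hk0 : ∀ j, 0 < k j)
    (hcard : ∀ j, {h : ZMod m → F | inMinIdeal (Fintype.card F) ζ (it j) h}.ncard =
      Fintype.card F ^ k j)
    {s : Fin U → ι → F} (hs : ∀ j, ∃ v, s j v ≠ 0) :
    {O : Set (ZMod m × ι → F) | ∃ c ∈ {c | c ∈ combineColumns (m := m) s ''
        {h | ∀ j, inMinIdeal (Fintype.card F) ζ (it j) (h j)} ∧ c ≠ 0},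
      O = MulAction.orbit (AffineScalar F u) c}.ncard *
        (orderOf u * m * (Fintype.card F - 1)) =
      ∑ S : Finset (Fin U) with S.Nonempty, ∑ r ∈ Finset.range (orderOf u),
        bigGcd (Fintype.card F) m it k S r *
          Nat.gcd (Fintype.card F - 1) (S.gcd fun j => Ifac (Fintype.card F) (k j) r) *
          ∏ j ∈ S, (Fintype.card F ^ Nat.gcd (k j) r - 1) := by
  classical
  have : Finite (AffineScalar F u) := Finite.of_equiv _ AffineScalar.equivProd.symm
  have := Fintype.ofFinite (AffineScalar F u)
  rw [← AffineScalar.card_eq, MulAction.ncard_orbits_mul_card _ (Set.toFinite _),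
    AffineScalar.sum_eq, Finset.sum_comm (γ := Finset (Fin U))]
  · refine Finset.sum_congr rfl fun r _ => ?_
    have h := fun t b => AffineScalar.ncard_fixed_ne_zero hζ hu hdist hk hk0 hcard hs b t r
    simp only [Set.mem_ofPred_eq] at h ⊢
    simp only [h]
    rw [Finset.sum_congr rfl fun t _ => Finset.sum_comm, Finset.sum_comm]
    refine Finset.sum_congr rfl fun S _ => ?_
    have hS := sum_ncard_units_pow_eq_one (F := F) hζ it
      (fun j => Ifac (Fintype.card F) (k j) r) S
    change _ = (bigGcd (Fintype.card F) m it k S r) * _ at hS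
    rw [← hS, Finset.sum_mul]
    refine Finset.sum_congr rfl fun t _ => ?_
    rw [← Finset.sum_filter, Finset.sum_const, smul_eq_mul, Set.ncard_eq_toFinset_card']
    congr 2
    ext
    simp
  · rintro g _ ⟨⟨h, hh, rfl⟩, h0⟩
    refine ⟨?_, ?_⟩
    · rw [AffineScalar.smul_combineColumns]
      exact ⟨_, fun j => inMinIdeal_affine hζ hu _ _ g.mult.2 (hh j), rfl⟩
    · intro hz
      refine h0 ?_
      rw [← inv_smul_smul g (combineColumns s h), hz]
      funext p
      simp [AffineScalar.smul_apply]

end OrbitCount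

/-- Let `C = C_{t₁} ⊕ ⋯ ⊕ C_{t_U}` be a one-generator quasi-cyclic code of
length `lm` and index `l` over `F_q`, each `C_{t_j}` a one-dimensional code over the minimal
ideal `R_m ε_{t_j}` with generator entries in `{0, f_j(x)}`.  Then the number `N` of orbits
of `⟨μ_q, ρ^l, M⟩` on `C \ {0}` equals `Σ_{∅ ≠ S ⊆ {1,…,U}} N_S`, where
`N_S = (1/(m' m (q-1))) Σ_{r=0}^{m'-1} gcd(m, …) · gcd(I, I_{t_{j₁}}, …, I_{t_{j_u}})
       · ∏_{j∈S} (q^{gcd(k_{t_j}, r)} - 1)`;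
in particular `s(C) ≤ N`. -/
theorem orbits_multiplier_shift_scalar_direct_sum {F E : Type*} [Field F] [Fintype F]
    [DecidableEq F] [Field E] [Algebra F E] {m l U : ℕ} [NeZero m] (hl : 2 ≤ l)
    (hco : Nat.Coprime m (Fintype.card F))
    (u : (ZMod m)ˣ) (hu : u = ZMod.unitOfCoprime (Fintype.card F) hco.symm)
    (m' : ℕ) (hm' : m' = orderOf u)
    (ζ : E) (hζ : IsPrimitiveRoot ζ m)
    (it k : Fin U → ℕ)
    (f : Fin U → ZMod m → F)
    (hf : ∀ j, inMinIdeal (Fintype.card F) ζ (it j) (f j))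
    (a : Fin U → Fin l → ZMod m → F) (ha : ∀ j v, a j v = 0 ∨ a j v = f j)
    (Ct : Fin U → Set ((ZMod m × Fin l) → F))
    (hCt : ∀ j, Ct j = {c | ∃ g : ZMod m → F, inMinIdeal (Fintype.card F) ζ (it j) g ∧
      ∀ (i : ZMod m) (v : Fin l), c (i, v) = cconv g (a j v) i})
    (hk : ∀ j, (cycCoset (Fintype.card F) m (it j)).ncard = k j)
    (hcard : ∀ j, (Ct j).ncard = Fintype.card F ^ k j)
    (hdist : ∀ j j' : Fin U, j ≠ j' →
      cycCoset (Fintype.card F) m (it j) ≠ cycCoset (Fintype.card F) m (it j'))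
    (C : Set ((ZMod m × Fin l) → F))
    (hCsum : C = {c | ∃ g : Fin U → ((ZMod m × Fin l) → F),
      (∀ j, g j ∈ Ct j) ∧ c = ∑ j : Fin U, g j})
    (N : ℕ)
    (hN : Set.ncard {O : Set ((ZMod m × Fin l) → F) | ∃ c, c ∈ C ∧ c ≠ 0 ∧
      O = {x | ∃ (r₁ r₂ : ℤ) (b : Fˣ),
        (multiplierQC F m l u ^ r₁) ((shiftQC F m l ^ r₂) ((b : F) • c)) = x}} = N) :
    (N : ℚ) = ∑ S : Finset (Fin U), (if S.Nonempty then
        ((∑ r ∈ Finset.range m',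
            bigGcd (Fintype.card F) m it k S r *
              Nat.gcd (Fintype.card F - 1) (S.gcd fun j => Ifac (Fintype.card F) (k j) r) *
              ∏ j ∈ S, (Fintype.card F ^ Nat.gcd (k j) r - 1) : ℕ) : ℚ) /
          ((m' : ℚ) * (m : ℚ) * ((Fintype.card F : ℚ) - 1))
      else 0) ∧
    Set.ncard {w : ℕ | ∃ c, c ∈ C ∧ c ≠ 0 ∧ hammingNorm c = w} ≤ N := by
  classical
  subst hm' hCsum hN
  have hu' : (u : ZMod m) = Fintype.card F := by rw [hu, ZMod.coe_unitOfCoprime]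
  have hk0 : ∀ j, 0 < k j := fun j =>
    hk j ▸ (Set.ncard_pos (Set.toFinite _)).2 ⟨_, mem_cycCoset_self _ _⟩
  have hgen := fun j => exists_scalars_of_generator (F := F) hζ hu' (hk j) (hk0 j) (a j) (ha j)
    (hCt j ▸ hcard j)
  simp only [← hCt] at hgen
  choose hW s hs hCs using hgen
  have hC : {c | ∃ g : Fin U → ((ZMod m × Fin l) → F), (∀ j, g j ∈ Ct j) ∧ c = ∑ j, g j} =
      combineColumns (m := m) s ''
        {h | ∀ j, inMinIdeal (Fintype.card F) ζ (it j) (h j)} := by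
    ext c
    constructor
    · rintro ⟨g, hg, rfl⟩
      simp only [hCs] at hg
      choose h hh hg using hg
      refine ⟨h, hh, ?_⟩
      funext p
      simp only [← hg, Finset.sum_apply, combineColumns]
    · rintro ⟨h, hh, rfl⟩
      refine ⟨fun j p => s j p.2 * h j p.1, fun j => hCs j ▸ ⟨h j, hh j, rfl⟩, ?_⟩
      funext p
      simp only [Finset.sum_apply, combineColumns]
  set X := {c | ∃ g : Fin U → ((ZMod m × Fin l) → F), (∀ j, g j ∈ Ct j) ∧ c = ∑ j, g j} with hX
  simp only [AffineScalar.orbit_eq]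
  have hmain := AffineScalar.ncard_orbits_mul hζ hu' hdist hk hk0 hW hs
  rw [← hC] at hmain
  simp only [Set.mem_ofPred_eq, and_assoc] at hmain
  constructor
  · rw [← Finset.sum_filter, ← Finset.sum_div, ← Nat.cast_sum, ← hmain]
    have h1 : (1 : ℕ) < Fintype.card F := Fintype.one_lt_card
    have h2 : (Fintype.card F : ℚ) - 1 ≠ 0 := by
      have : (1 : ℚ) < Fintype.card F := by exact_mod_cast h1
      linarith
    have h3 : (orderOf u : ℚ) ≠ 0 := by exact_mod_cast (orderOf_pos u).ne'
    have h4 : (m : ℚ) ≠ 0 := by exact_mod_cast NeZero.ne m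
    rw [Nat.cast_mul, Nat.cast_mul, Nat.cast_mul, Nat.cast_sub h1.le, Nat.cast_one]
    field_simp
  · have hw : ∀ w : {w : ℕ | ∃ c, c ∈ X ∧ c ≠ 0 ∧ hammingNorm c = w},
        ∃ c, c ∈ X ∧ c ≠ 0 ∧ hammingNorm c = w := fun w => w.2
    choose c hcX hc0 hcw using hw
    rw [← Nat.card_coe_set_eq, ← Nat.card_coe_set_eq]
    refine Nat.card_le_card_of_injective
      (fun w => ⟨MulAction.orbit (AffineScalar F u) (c w), c w, hcX w, hc0 w, rfl⟩) ?_
    intro w w' hww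
    obtain ⟨g, hg⟩ := MulAction.orbit_eq_iff.1 (congrArg Subtype.val hww)
    refine Subtype.ext ?_
    rw [← hcw w, ← hcw w', ← hg]
    exact AffineScalar.hammingNorm_smul g _
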